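/- Let (Ω,≤) be a totally ordered set on which Aut(Ω,≤) acts transitively. If Aut(Ω,≤) and Aut(ℝ,≤) are elementarily equivalent in the first-order language of lattice-ordered groups, then Ω is isomorphic to ℝ as an ordered set. -/

import Mathlib

/-!  Common framework for ℓ-permutation groups on a totally ordered set. -/

namespace LPerm

variable {Ω : Type*} [LinearOrder Ω]

/-- Pointwise join of two order automorphisms of a totally ordered set. -/
def autSup (f g : Ω ≃o Ω) : Ω ≃o Ω :=
  Equiv.toOrderIso
    { toFun := fun α => max (f α) (g α)
      invFun := fun α => min (f.symm α) (g.symm α)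
      left_inv := by
        intro α
        dsimp only
        rcases le_total (f α) (g α) with h | h
        · rw [max_eq_right h]
          have h1 : α ≤ f.symm (g α) := by
            have := f.symm.monotone h
            simpa using this
          rw [g.symm_apply_apply, min_eq_right h1]
        · rw [max_eq_left h]
          have h1 : α ≤ g.symm (f α) := by
            have := g.symm.monotone h
            simpa using this
          rw [f.symm_apply_apply, min_eq_left h1]
      right_inv := by
        intro α
        dsimp only
        rcases le_total (f.symm α) (g.symm α) with h | h
        · rw [min_eq_left h]
          have h1 : g (f.symm α) ≤ α := by
            have := g.monotone h
            simpa using this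
          rw [f.apply_symm_apply, max_eq_left h1]
        · rw [min_eq_right h]
          have h1 : f (g.symm α) ≤ α := by
            have := f.monotone h
            simpa using this
          rw [g.apply_symm_apply, max_eq_right h1] }
    (f.monotone.max g.monotone)
    (f.symm.monotone.min g.symm.monotone)

/-- Pointwise meet of two order automorphisms of a totally ordered set. -/
def autInf (f g : Ω ≃o Ω) : Ω ≃o Ω :=
  Equiv.toOrderIso
    { toFun := fun α => min (f α) (g α)
      invFun := fun α => max (f.symm α) (g.symm α)
      left_inv := by
        intro α
        dsimp only
        rcases le_total (f α) (g α) with h | h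
        · rw [min_eq_left h]
          have h1 : g.symm (f α) ≤ α := by
            have := g.symm.monotone h
            simpa using this
          rw [f.symm_apply_apply, max_eq_left h1]
        · rw [min_eq_right h]
          have h1 : f.symm (g α) ≤ α := by
            have := f.symm.monotone h
            simpa using this
          rw [g.symm_apply_apply, max_eq_right h1]
      right_inv := by
        intro α
        dsimp only
        rcases le_total (f.symm α) (g.symm α) with h | h
        · rw [max_eq_right h]
          have h1 : α ≤ f (g.symm α) := by
            have := f.monotone h
            simpa using this
          rw [g.apply_symm_apply, min_eq_right h1]
        · rw [max_eq_left h]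
          have h1 : α ≤ g (f.symm α) := by
            have := g.monotone h
            simpa using this
          rw [f.apply_symm_apply, min_eq_left h1] }
    (f.monotone.min g.monotone)
    (f.symm.monotone.max g.symm.monotone)


/-- The pointwise order on order automorphisms: `f ≤ g` iff `f α ≤ g α` for all `α`. -/
def autLe (f g : Ω ≃o Ω) : Prop := ∀ α : Ω, f α ≤ g α

/-- `|g| = g ∨ g⁻¹`. -/
def autAbs (g : Ω ≃o Ω) : Ω ≃o Ω := autSup g g⁻¹

/-- The support of an automorphism. -/
def supp (g : Ω ≃o Ω) : Set Ω := {α | g α ≠ α}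

/-- Conjugation, written `h^g = g⁻¹ h g` in the paper. -/
def aconj (h g : Ω ≃o Ω) : Ω ≃o Ω := g⁻¹ * h * g

/-- The commutator `[a,b] = a⁻¹ b⁻¹ a b`. -/
def pcomm (a b : Ω ≃o Ω) : Ω ≃o Ω := a⁻¹ * b⁻¹ * a * b

/-- `G` is closed under the pointwise lattice operations, i.e. `(G,Ω)` is an
ℓ-permutation group. -/
def SublatticeClosed (G : Subgroup (Ω ≃o Ω)) : Prop :=
  ∀ f g : Ω ≃o Ω, f ∈ G → g ∈ G → autSup f g ∈ G ∧ autInf f g ∈ G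

/-- `(G,Ω)` is transitive. -/
def IsTransitive (G : Subgroup (Ω ≃o Ω)) : Prop :=
  ∀ α β : Ω, ∃ g ∈ G, g α = β

/-- `(G,Ω)` is o-2 transitive. -/
def IsO2Transitive (G : Subgroup (Ω ≃o Ω)) : Prop :=
  ∀ α₁ α₂ β₁ β₂ : Ω, α₁ < α₂ → β₁ < β₂ → ∃ g ∈ G, g α₁ = β₁ ∧ g α₂ = β₂

/-- A convex `G`-congruence: an equivalence relation with convex classes which is
preserved by the action of `G`. -/
def IsConvexCongruence (G : Subgroup (Ω ≃o Ω)) (r : Ω → Ω → Prop) : Prop :=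
  Equivalence r ∧ (∀ α β γ : Ω, r α γ → α ≤ β → β ≤ γ → r α β) ∧
    ∀ g ∈ G, ∀ α β : Ω, r α β → r (g α) (g β)

/-- `V(α,β)`: the intersection of all convex `G`-congruences under which `α` and `β`
are equivalent. -/
def Vcong (G : Subgroup (Ω ≃o Ω)) (α β : Ω) : Ω → Ω → Prop :=
  fun γ δ => ∀ r : Ω → Ω → Prop, IsConvexCongruence G r → r α β → r γ δ

/-- Membership in the spine `𝔎` of `(G,Ω)`. -/
def SpineMem (G : Subgroup (Ω ≃o Ω)) (r : Ω → Ω → Prop) : Prop :=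
  ∃ α β : Ω, α ≠ β ∧ r = Vcong G α β

/-- Inclusion of relations. -/
def relLe (r s : Ω → Ω → Prop) : Prop := ∀ x y : Ω, r x y → s x y

/-- `Δ ∈ T`: `Δ` is an o-block (class) of a member of the spine `𝔎`. -/
def InT (G : Subgroup (Ω ≃o Ω)) (Δ : Set Ω) : Prop :=
  ∃ r : Ω → Ω → Prop, SpineMem G r ∧ ∃ δ : Ω, Δ = {γ | r δ γ}

/-- `Δ` is a class (o-block) of the relation `r`. -/
def IsBlockOf (r : Ω → Ω → Prop) (Δ : Set Ω) : Prop :=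
  ∃ δ : Ω, Δ = {γ | r δ γ}

/-- The restricted stabiliser `rst(S) = {g ∈ G ∣ supp g ⊆ S}`. -/
def rst (G : Subgroup (Ω ≃o Ω)) (S : Set Ω) : Set (Ω ≃o Ω) :=
  {g | g ∈ G ∧ supp g ⊆ S}

/-- The (setwise) stabiliser `st(Δ) = {g ∈ G ∣ Δg = Δ}`. -/
def stab (G : Subgroup (Ω ≃o Ω)) (Δ : Set Ω) : Set (Ω ≃o Ω) :=
  {g | g ∈ G ∧ g '' Δ = Δ}

/-- `Q_Δ = {h ∈ rst(Δ) ∣ ∃ α ∈ Δ, V(α, αh) = κ(Δ)}`; since `κ(Δ)` is the unique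
convex congruence having `Δ` as a class, the condition `V(α,αh) = κ(Δ)` says exactly
that `Δ` is the class of `V(α, αh)` containing `α`. -/
def Qset (G : Subgroup (Ω ≃o Ω)) (Δ : Set Ω) : Set (Ω ≃o Ω) :=
  {h | h ∈ rst G Δ ∧ ∃ α ∈ Δ, Δ = {γ | Vcong G α (h α) α γ}}

/-- `(G,Ω)` is ample: `Q_Δ ≠ ∅` for every `Δ ∈ T`. -/
def Ample (G : Subgroup (Ω ≃o Ω)) : Prop :=
  ∀ Δ : Set Ω, InT G Δ → (Qset G Δ).Nonempty

/-- `(G,Ω)` is abundant: for every `Δ ∈ T` and `g ∈ st(Δ)`, the automorphism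
`dep(g,Δ)` agreeing with `g` on `Δ` and with the identity elsewhere lies in `G`. -/
def Abundant (G : Subgroup (Ω ≃o Ω)) : Prop :=
  ∀ Δ : Set Ω, InT G Δ → ∀ g ∈ stab G Δ,
    ∃ g₀ ∈ G, (∀ α ∈ Δ, g₀ α = g α) ∧ ∀ α ∉ Δ, g₀ α = α

/-- The spine `𝔎` has no minimal element. -/
def SpineNoMin (G : Subgroup (Ω ≃o Ω)) : Prop :=
  ∀ r : Ω → Ω → Prop, SpineMem G r →
    ∃ r' : Ω → Ω → Prop, SpineMem G r' ∧ relLe r' r ∧ r' ≠ r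

/-- `Δ` is a minimal element of `T`. -/
def MinimalInT (G : Subgroup (Ω ≃o Ω)) (Δ : Set Ω) : Prop :=
  InT G Δ ∧ ∀ Δ' : Set Ω, InT G Δ' → Δ' ⊆ Δ → Δ' = Δ

/-- Hypothesis (†): if `T` has a minimal element `Δ₀`, then every (nondegenerate
bounded) interval of `Δ₀` supports a non-trivial element of `G`. -/
def Dagger (G : Subgroup (Ω ≃o Ω)) : Prop :=
  ∀ Δ₀ : Set Ω, MinimalInT G Δ₀ → ∀ α β : Ω, α ∈ Δ₀ → β ∈ Δ₀ → α < β →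
    ∃ g : Ω ≃o Ω, g ∈ G ∧ g ≠ 1 ∧ supp g ⊆ Set.Ioo α β

/-- `X_h = {[h⁻¹, h^g] ∣ g ∈ G}`. -/
def Xset (G : Subgroup (Ω ≃o Ω)) (h : Ω ≃o Ω) : Set (Ω ≃o Ω) :=
  {x | ∃ g ∈ G, x = pcomm h⁻¹ (aconj h g)}

/-- `W_h = ⋃ {X_{h^g} ∣ g ∈ G, [X_h, X_{h^g}] ≠ 1}`. -/
def Wset (G : Subgroup (Ω ≃o Ω)) (h : Ω ≃o Ω) : Set (Ω ≃o Ω) :=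
  {x | ∃ g ∈ G, (∃ a ∈ Xset G h, ∃ b ∈ Xset G (aconj h g), pcomm a b ≠ 1) ∧
    x ∈ Xset G (aconj h g)}

/-- The centraliser of a subset `S` in `G`. -/
def cent (G : Subgroup (Ω ≃o Ω)) (S : Set (Ω ≃o Ω)) : Set (Ω ≃o Ω) :=
  {f | f ∈ G ∧ ∀ s ∈ S, s * f = f * s}

/-- The double centraliser of a subset `S` in `G`. -/
def cent2 (G : Subgroup (Ω ≃o Ω)) (S : Set (Ω ≃o Ω)) : Set (Ω ≃o Ω) :=
  cent G (cent G S)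

/-- The pointwise stabiliser in `G` of a subset `S ⊆ Ω`. -/
def ptStab (G : Subgroup (Ω ≃o Ω)) (S : Set Ω) : Set (Ω ≃o Ω) :=
  {f | f ∈ G ∧ ∀ α ∈ S, f α = α}

/-- The congruence covered by `K`: the union of all convex `G`-congruences properly
contained in `K`. -/
def coveredRel (G : Subgroup (Ω ≃o Ω)) (K : Ω → Ω → Prop) : Ω → Ω → Prop :=
  fun γ δ => ∃ r : Ω → Ω → Prop, IsConvexCongruence G r ∧ relLe r K ∧ r ≠ K ∧ r γ δ

/-- `Γ ∈ π(Δ)`, where `K = κ(Δ)`: `Γ` is a class of the congruence covered by `K`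
contained in `Δ`. -/
def InPi (G : Subgroup (Ω ≃o Ω)) (K : Ω → Ω → Prop) (Δ Γ : Set Ω) : Prop :=
  ∃ δ ∈ Δ, Γ = {γ | coveredRel G K δ γ}

/-- An irreducible element of `G`. -/
def IsIrreducibleElt (G : Subgroup (Ω ≃o Ω)) (g : Ω ≃o Ω) : Prop :=
  autLe 1 g ∧ g ≠ 1 ∧
    ∀ g₁ g₂ : Ω ≃o Ω, g₁ ∈ G → g₂ ∈ G → autSup g₁ g₂ = g → autInf g₁ g₂ = 1 →
      g₁ = 1 ∨ g₂ = 1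

/-- `(G,Ω)` is controlled. -/
def Controlled (G : Subgroup (Ω ≃o Ω)) : Prop :=
  ∀ Δ : Set Ω, InT G Δ → ¬ MinimalInT G Δ → ∀ g ∈ rst G Δ,
    (∃ δ ∈ Δ ∩ supp g, Δ = {γ | Vcong G δ (g δ) δ γ}) ∨
      ∃ Δ' : Set Ω, InT G Δ' ∧ supp g ⊆ Δ' ∧ Δ' ⊂ Δ


/-- Function symbols of the first-order language of lattice-ordered groups:
multiplication, inversion, identity, join and meet. -/
inductive LGFunc : ℕ → Type
  | mul : LGFunc 2
  | inv : LGFunc 1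
  | one : LGFunc 0
  | join : LGFunc 2
  | meet : LGFunc 2

/-- The first-order language of lattice-ordered groups. -/
def LGLang : FirstOrder.Language where
  Functions := LGFunc
  Relations := fun _ => Empty

/-- The automorphism group of a totally ordered set as a structure for the
first-order language of lattice-ordered groups, with the pointwise lattice
operations. -/
noncomputable instance autLGStructure (Ω : Type*) [LinearOrder Ω] :
    LGLang.Structure (Ω ≃o Ω) where
  funMap {_} f x :=
    match f with
    | .mul => x 0 * x 1
    | .inv => (x 0)⁻¹
    | .one => 1
    | .join => autSup (x 0) (x 1)
    | .meet => autInf (x 0) (x 1)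
  RelMap {_} r _ := r.elim

/-! ### Pointwise facts -/

/-- `h` is a nontrivial positive automorphism. -/
def IsPos (h : Ω ≃o Ω) : Prop := autLe 1 h ∧ h ≠ 1

/-- Every upward conjugate of `p` is disjoint from `h`. -/
def Above (p h : Ω ≃o Ω) : Prop :=
  ∀ u : Ω ≃o Ω, autLe 1 u → autInf (u * p * u⁻¹) h = 1

/-- `c` is not the join of two nontrivial disjoint automorphisms. -/
def IsIndecomposable (c : Ω ≃o Ω) : Prop :=
  ∀ a b : Ω ≃o Ω, autSup a b = c → autInf a b = 1 → a = 1 ∨ b = 1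

/-- No nontrivial positive automorphism is disjoint from `c`. -/
def IsWeakUnit (c : Ω ≃o Ω) : Prop :=
  ∀ h : Ω ≃o Ω, autLe 1 h → autInf c h = 1 → h = 1

/-- `c` commutes with both `f` and `g`. -/
def Centralizes (f g c : Ω ≃o Ω) : Prop := c * f = f * c ∧ c * g = g * c

variable (Ω) in
/-- Below every positive automorphism there are two positive ones, one above the other. -/
def HasSplitting : Prop :=
  ∀ h : Ω ≃o Ω, IsPos h → ∃ p q : Ω ≃o Ω,
    IsPos p ∧ IsPos q ∧ autLe p h ∧ autLe q h ∧ Above p q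

/-- The centralizer of `f` and `g` is a totally ordered group of indecomposable weak units,
containing approximate square roots and arbitrarily small positive elements. -/
def IsScalePair (f g : Ω ≃o Ω) : Prop :=
  (∀ c, Centralizes f g c → IsPos c → IsIndecomposable c ∧ IsWeakUnit c) ∧
  (∀ c, Centralizes f g c → ∀ d, Centralizes f g d → autLe c d ∨ autLe d c) ∧
  (∀ c, Centralizes f g c → IsPos c → ∃ d, Centralizes f g d ∧ IsPos d ∧ autLe (d * d) c) ∧
  ∀ h, IsPos h → ∃ c, Centralizes f g c ∧ IsPos c ∧ ¬ autLe h c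

/-- Any two positive automorphisms with bounded support have, up to conjugation, the same
positive automorphisms above them. -/
def CutsConjugate (Ω : Type*) [LinearOrder Ω] : Prop :=
  ∀ a b : Ω ≃o Ω, IsPos a → IsPos b →
    (∃ p, IsPos p ∧ Above p a) → (∃ p, IsPos p ∧ Above p b) →
    ∃ k a' : Ω ≃o Ω, k * a = a' * k ∧ ∀ p, IsPos p → (Above p a' ↔ Above p b)

theorem autSup_apply (f g : Ω ≃o Ω) (x : Ω) : autSup f g x = max (f x) (g x) := rfl

theorem autInf_apply (f g : Ω ≃o Ω) (x : Ω) : autInf f g x = min (f x) (g x) := rfl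

theorem autSup_eq_right_iff {f g : Ω ≃o Ω} : autSup f g = g ↔ autLe f g := by
  constructor
  · intro h x
    rw [← h, autSup_apply]
    exact le_max_left _ _
  · intro h
    ext x
    rw [autSup_apply, max_eq_right (h x)]

theorem IsPos.le_apply {h : Ω ≃o Ω} (hh : IsPos h) (x : Ω) : x ≤ h x := hh.1 x

theorem IsPos.lt_apply {h : Ω ≃o Ω} (hh : IsPos h) {x : Ω} (hx : h x ≠ x) : x < h x :=
  lt_of_le_of_ne (hh.le_apply x) hx.symm

theorem exists_ne_of_ne_one {h : Ω ≃o Ω} (hh : h ≠ 1) : ∃ x, h x ≠ x := by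
  by_contra! H
  exact hh (by ext x; exact H x)

theorem isPos_of_le {h : Ω ≃o Ω} (hle : ∀ x, x ≤ h x) {x : Ω} (hx : h x ≠ x) : IsPos h :=
  ⟨hle, fun h1 => hx (by rw [h1]; rfl)⟩

theorem IsPos.conj {p : Ω ≃o Ω} (hp : IsPos p) (u : Ω ≃o Ω) : IsPos (u * p * u⁻¹) := by
  obtain ⟨x, hx⟩ := exists_ne_of_ne_one hp.2
  refine isPos_of_le (x := u x) (fun y => ?_) ?_
  · have := u.monotone (hp.le_apply (u⁻¹ y))
    simpa using this
  · simpa using hx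

theorem conj_apply_ne_iff {p u : Ω ≃o Ω} {x : Ω} :
    (u * p * u⁻¹) x ≠ x ↔ p (u⁻¹ x) ≠ u⁻¹ x := by
  have : x = u (u⁻¹ x) := by simp
  constructor
  · intro h h'
    apply h
    rw [RelIso.mul_apply, RelIso.mul_apply, h', ← this]
  · intro h h'
    apply h
    apply u.injective
    rw [← this]
    simpa using h'

theorem apply_ne_of_le {p h : Ω ≃o Ω} (hp : IsPos p) (hle : autLe p h) {x : Ω}
    (hx : p x ≠ x) : h x ≠ x :=
  ((hp.lt_apply hx).trans_le (hle x)).ne'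

/-- Positive elements are disjoint exactly when their supports are. -/
theorem autInf_eq_one_iff {p h : Ω ≃o Ω} (hp : autLe 1 p) (hh : autLe 1 h) :
    autInf p h = 1 ↔ ∀ x, p x = x ∨ h x = x := by
  constructor
  · intro H x
    have hx : min (p x) (h x) = x := by
      rw [← autInf_apply, H]; rfl
    rcases min_choice (p x) (h x) with h1 | h1
    · left; rw [← h1, hx]
    · right; rw [← h1, hx]
  · intro H
    ext x
    rw [autInf_apply]
    have h1 : x ≤ p x := hp x
    have h2 : x ≤ h x := hh x
    rcases H x with h3 | h3
    · rw [h3, min_eq_left h2]; rfl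
    · rw [h3, min_eq_right h1]; rfl

theorem above_iff (htrans : ∀ α β : Ω, ∃ g : Ω ≃o Ω, g α = β) {p h : Ω ≃o Ω}
    (hp : IsPos p) (hh : IsPos h) :
    Above p h ↔ ∀ x y, p x ≠ x → h y ≠ y → y < x := by
  constructor
  · intro H x y hx hy
    by_contra! hxy
    obtain ⟨u, hu⟩ := htrans x y
    have hs : autSup 1 u x = y := by
      rw [autSup_apply, hu]; exact max_eq_right hxy
    have h1 : autLe 1 (autSup 1 u) := fun z => le_max_left _ _
    rcases (autInf_eq_one_iff (hp.conj _).1 hh.1).1 (H _ h1) y with h2 | h2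
    · refine conj_apply_ne_iff.2 ?_ h2
      rw [← hs]
      simpa using hx
    · exact hy h2
  · intro H u hu
    rw [autInf_eq_one_iff (hp.conj _).1 hh.1]
    intro y
    by_contra! h2
    have h3 := H _ y (conj_apply_ne_iff.1 h2.1) h2.2
    have h4 : u⁻¹ y ≤ y := by simpa using hu (u⁻¹ y)
    exact absurd h3 h4.not_gt

/-! ### Gluing automorphisms -/

/-- Glue automorphisms that preserve the fibres of a monotone map. -/
theorem exists_glue {ι : Type*} [PartialOrder ι] {m : Ω → ι} (hm : Monotone m)
    (g : ι → (Ω ≃o Ω)) (hg : ∀ i x, m (g i x) = m x) :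
    ∃ h : Ω ≃o Ω, ∀ x, h x = g (m x) x := by
  have hmono : StrictMono fun x => g (m x) x := by
    intro x y hxy
    rcases (hm hxy.le).eq_or_lt with h | h
    · simpa [h] using hxy
    · by_contra! h'
      have := hm h'
      simp only [hg] at this
      exact absurd this h.not_ge
  have hsurj : Function.Surjective fun x => g (m x) x := by
    intro y
    refine ⟨(g (m y))⁻¹ y, ?_⟩
    have : m ((g (m y))⁻¹ y) = m y := by
      rw [← hg (m y) ((g (m y))⁻¹ y)]
      simp
    simp [this]
  exact ⟨hmono.orderIsoOfSurjective _ hsurj, fun x => rfl⟩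

theorem exists_splice {D : Set Ω} (hD : IsLowerSet D) {a b : Ω ≃o Ω}
    (ha : ∀ x, a x ∈ D ↔ x ∈ D) (hb : ∀ x, b x ∈ D ↔ x ∈ D) :
    ∃ h : Ω ≃o Ω, (∀ x ∈ D, h x = a x) ∧ ∀ x ∉ D, h x = b x := by
  classical
  obtain ⟨h, hh⟩ := exists_glue (m := fun x => x ∉ D)
    (fun x y hxy (hx : x ∉ D) hy => hx (hD hxy hy))
    (fun i => if i then b else a) (fun i x => by
      by_cases hi : i <;> simp [hi, ha, hb])
  exact ⟨h, fun x hx => by simp [hh, hx], fun x hx => by simp [hh, hx]⟩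

/-! ### Supports inside intervals -/

theorem exists_pos_supp_subset_class (htrans : ∀ α β : Ω, ∃ g : Ω ≃o Ω, g α = β)
    {r : Ω → Ω → Prop} (hr : Equivalence r)
    (hconv : ∀ x y z, r x z → x ≤ y → y ≤ z → r x y)
    (hinv : ∀ (g : Ω ≃o Ω) x y, r x y → r (g x) (g y)) {β γ : Ω} (hlt : β < γ)
    (hβγ : r β γ) : ∃ h : Ω ≃o Ω, IsPos h ∧ ∀ x, h x ≠ x → r β x := by
  obtain ⟨k₀, hk₀⟩ := htrans β γ
  obtain ⟨k, hk1, hk⟩ : ∃ k : Ω ≃o Ω, (∀ x, x ≤ k x) ∧ k β = γ :=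
    ⟨autSup 1 k₀, fun x => le_max_left _ _, by
      rw [autSup_apply, hk₀]; exact max_eq_right hlt.le⟩
  have hE : ∀ x, r β (k x) ↔ r β x := by
    intro x
    constructor
    · intro h
      have := hinv k⁻¹ _ _ (hr.trans (hr.symm hβγ) h)
      rw [← hk] at this
      simpa using this
    · intro h
      have := hinv k _ _ h
      rw [hk] at this
      exact hr.trans hβγ this
  have hE' : ∀ x, r β (k⁻¹ x) ↔ r β x := by
    intro x
    rw [← hE]
    simp
  have hM : ∀ x, (∀ y, r β y → k x < y) ↔ ∀ y, r β y → x < y := by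
    intro x
    constructor
    · intro h y hy
      exact (hk1 x).trans_lt (h y hy)
    · intro h y hy
      have := k.strictMono (h _ ((hE' y).2 hy))
      simpa using this
  have hL : ∀ x, (∃ y, r β y ∧ k x ≤ y) ↔ ∃ y, r β y ∧ x ≤ y := by
    intro x
    constructor
    · rintro ⟨y, hy, hxy⟩
      exact ⟨y, hy, (hk1 x).trans hxy⟩
    · rintro ⟨y, hy, hxy⟩
      exact ⟨k y, (hE y).2 hy, k.monotone hxy⟩
  obtain ⟨a, ha1, ha2⟩ := exists_splice (D := {x | ∀ y, r β y → x < y})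
    (fun x y hxy hx z hz => hxy.trans_lt (hx z hz)) (a := 1) (b := k)
    (fun x => Iff.rfl) hM
  have haL : ∀ x, (∃ y, r β y ∧ a x ≤ y) ↔ ∃ y, r β y ∧ x ≤ y := by
    intro x
    by_cases hx : ∀ y, r β y → x < y
    · rw [ha1 x hx]; rfl
    · rw [ha2 x hx, hL]
  obtain ⟨h, h1, h2⟩ := exists_splice (D := {x | ∃ y, r β y ∧ x ≤ y})
    (fun x y hxy ⟨z, hz, hz'⟩ => ⟨z, hz, hxy.trans hz'⟩) (a := a) (b := 1) haL
    (fun x => Iff.rfl)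
  have hβ : h β = γ := by
    rw [h1 β ⟨β, hr.refl β, le_rfl⟩, ha2 β (fun H => lt_irrefl _ (H β (hr.refl β))), hk]
  refine ⟨h, isPos_of_le (fun x => ?_) (hβ.trans_ne hlt.ne'), fun x hx => ?_⟩
  · by_cases hxL : ∃ y, r β y ∧ x ≤ y
    · rw [h1 x hxL]
      by_cases hx : ∀ y, r β y → x < y
      · exact (ha1 x hx).ge
      · rw [ha2 x hx]
        exact hk1 x
    · exact (h2 x hxL).ge
  · by_cases hxL : ∃ y, r β y ∧ x ≤ y
    · by_cases hxM : ∀ y, r β y → x < y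
      · exact absurd ((h1 x hxL).trans (ha1 x hxM)) hx
      · push Not at hxM
        obtain ⟨y, hy, hyx⟩ := hxM
        obtain ⟨z, hz, hxz⟩ := hxL
        exact hr.trans hy (hconv _ _ _ (hr.trans (hr.symm hy) hz) hyx hxz)
    · exact absurd (h2 x hxL) hx

theorem exists_pos_starting_between (htrans : ∀ α β : Ω, ∃ g : Ω ≃o Ω, g α = β)
    (hsplit : HasSplitting Ω) {β γ : Ω} (hlt : β < γ) :
    ∃ p : Ω ≃o Ω, IsPos p ∧ (∀ z, p z ≠ z → β < z) ∧ ∃ z, p z ≠ z ∧ z ≤ γ := by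
  by_contra! H
  obtain ⟨h, hpos, hsupp⟩ := exists_pos_supp_subset_class htrans
    (r := fun x y => ∀ p : Ω ≃o Ω, IsPos p →
      ((∀ z, p z ≠ z → x < z) ↔ ∀ z, p z ≠ z → y < z))
    ⟨fun x p _ => Iff.rfl, fun h p hp => (h p hp).symm,
      fun h h' p hp => (h p hp).trans (h' p hp)⟩
    (fun x y w hxw hxy hyw p hp =>
      ⟨fun h z hz => hyw.trans_lt ((hxw p hp).1 h z hz), fun h z hz => hxy.trans_lt (h z hz)⟩)
    (fun g x y hxy p hp => by
      have key : ∀ w, (∀ z, p z ≠ z → g w < z) ↔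
          ∀ z, (g⁻¹ * p * g⁻¹⁻¹) z ≠ z → w < z := by
        intro w
        constructor
        · intro h z hz
          have := h _ (conj_apply_ne_iff.1 hz)
          simpa using this
        · intro h z hz
          have := g.strictMono (h (g⁻¹ z) (conj_apply_ne_iff.2 (by simpa using hz)))
          simpa using this
      rw [key, key]
      exact hxy _ (hp.conj _))
    hlt (fun p hp => ⟨fun h z hz => H p hp h z hz, fun h z hz => hlt.trans (h z hz)⟩)
  obtain ⟨p, q, hp, hq, hph, hqh, hpq⟩ := hsplit h hpos
  obtain ⟨x, hx⟩ := exists_ne_of_ne_one hp.2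
  obtain ⟨y, hy⟩ := exists_ne_of_ne_one hq.2
  rw [above_iff htrans hp hq] at hpq
  have h1 := hsupp x (apply_ne_of_le hp hph hx) p hp
  have h2 := hsupp y (apply_ne_of_le hq hqh hy) p hp
  exact lt_irrefl x ((h2.symm.trans h1).1 (fun z hz => hpq z y hz hy) x hx)

theorem exists_pos_ending_between (htrans : ∀ α β : Ω, ∃ g : Ω ≃o Ω, g α = β)
    (hsplit : HasSplitting Ω) {β γ : Ω} (hlt : β < γ) :
    ∃ p : Ω ≃o Ω, IsPos p ∧ (∀ z, p z ≠ z → z < γ) ∧ ∃ z, p z ≠ z ∧ β ≤ z := by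
  by_contra! H
  obtain ⟨h, hpos, hsupp⟩ := exists_pos_supp_subset_class htrans
    (r := fun x y => ∀ p : Ω ≃o Ω, IsPos p →
      ((∀ z, p z ≠ z → z < x) ↔ ∀ z, p z ≠ z → z < y))
    ⟨fun x p _ => Iff.rfl, fun h p hp => (h p hp).symm,
      fun h h' p hp => (h p hp).trans (h' p hp)⟩
    (fun x y w hxw hxy hyw p hp =>
      ⟨fun h z hz => (h z hz).trans_le hxy,
        fun h z hz => (hxw p hp).2 (fun z hz => (h z hz).trans_le hyw) z hz⟩)
    (fun g x y hxy p hp => by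
      have key : ∀ w, (∀ z, p z ≠ z → z < g w) ↔
          ∀ z, (g⁻¹ * p * g⁻¹⁻¹) z ≠ z → z < w := by
        intro w
        constructor
        · intro h z hz
          have := h _ (conj_apply_ne_iff.1 hz)
          simpa using this
        · intro h z hz
          have := g.strictMono (h (g⁻¹ z) (conj_apply_ne_iff.2 (by simpa using hz)))
          simpa using this
      rw [key, key]
      exact hxy _ (hp.conj _))
    hlt (fun p hp => ⟨fun h z hz => (h z hz).trans hlt, fun h z hz => H p hp h z hz⟩)
  obtain ⟨p, q, hp, hq, hph, hqh, hpq⟩ := hsplit h hpos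
  obtain ⟨x, hx⟩ := exists_ne_of_ne_one hp.2
  obtain ⟨y, hy⟩ := exists_ne_of_ne_one hq.2
  rw [above_iff htrans hp hq] at hpq
  have h1 := hsupp x (apply_ne_of_le hp hph hx) q hq
  have h2 := hsupp y (apply_ne_of_le hq hqh hy) q hq
  exact lt_irrefl y ((h1.symm.trans h2).1 (fun z hz => hpq x z hx hz) y hy)

variable (Ω) in
/-- Every nondegenerate open interval supports a positive automorphism. -/
def IntervalsSupport : Prop :=
  ∀ β γ : Ω, β < γ → ∃ h : Ω ≃o Ω, IsPos h ∧ ∀ x, h x ≠ x → β < x ∧ x < γ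

theorem intervalsSupport (htrans : ∀ α β : Ω, ∃ g : Ω ≃o Ω, g α = β)
    (hsplit : HasSplitting Ω) : IntervalsSupport Ω := by
  intro β γ hlt
  obtain ⟨δ, hβδ, hδγ⟩ : ∃ δ, β < δ ∧ δ < γ := by
    obtain ⟨p, hp, hp1, z, hz, hzγ⟩ := exists_pos_starting_between htrans hsplit hlt
    have hz' : p (p⁻¹ z) ≠ p⁻¹ z := by
      intro h
      apply hz
      have := congrArg p h
      simpa using this
    have := hp.lt_apply hz'
    rw [RelIso.apply_inv_self] at this
    exact ⟨p⁻¹ z, hp1 _ hz', this.trans_le hzγ⟩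
  obtain ⟨p, hp, hp1, x, hx, hxδ⟩ := exists_pos_starting_between htrans hsplit hβδ
  obtain ⟨q, hq, hq1, y, hy, hδy⟩ := exists_pos_ending_between htrans hsplit hδγ
  have hfix : ∀ {k : Ω ≃o Ω}, k δ = δ → ∀ x, k x ∈ Set.Iio δ ↔ x ∈ Set.Iio δ := by
    intro k hk x
    conv_lhs => rw [← hk]
    simp
  by_cases hpδ : p δ = δ
  · obtain ⟨h, h1, h2⟩ := exists_splice (isLowerSet_Iio δ) (a := p) (b := 1) (hfix hpδ)
      (fun x => Iff.rfl)
    have hxδ' : x < δ := lt_of_le_of_ne hxδ (by rintro rfl; exact hx hpδ)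
    refine ⟨h, isPos_of_le (x := x) (fun y => ?_) (by rwa [h1 x hxδ']), fun z hz => ?_⟩
    · by_cases hy : y < δ
      · rw [h1 y hy]; exact hp.le_apply y
      · exact (h2 y hy).ge
    · by_cases hzδ : z < δ
      · rw [h1 z hzδ] at hz
        exact ⟨hp1 z hz, hzδ.trans hδγ⟩
      · exact absurd (h2 z hzδ) hz
  by_cases hqδ : q δ = δ
  · obtain ⟨h, h1, h2⟩ := exists_splice (isLowerSet_Iio δ) (a := 1) (b := q)
      (fun x => Iff.rfl) (hfix hqδ)
    refine ⟨h, isPos_of_le (x := y) (fun y => ?_) (by rwa [h2 y hδy.not_gt]), fun z hz => ?_⟩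
    · by_cases hy : y < δ
      · exact (h1 y hy).ge
      · rw [h2 y hy]; exact hq.le_apply y
    · by_cases hzδ : z < δ
      · exact absurd (h1 z hzδ) hz
      · rw [h2 z hzδ] at hz
        exact ⟨hβδ.trans_le (not_lt.1 hzδ), hq1 z hz⟩
  have hle : autLe 1 (autInf p q) := fun x => le_min (hp.1 x) (hq.1 x)
  refine ⟨autInf p q, isPos_of_le (x := δ) hle ?_, fun z hz => ?_⟩
  · rw [autInf_apply]
    exact (lt_min (hp.lt_apply hpδ) (hq.lt_apply hqδ)).ne'
  · have hlt : z < min (p z) (q z) := lt_of_le_of_ne (hle z) (Ne.symm hz)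
    rw [lt_min_iff] at hlt
    exact ⟨hp1 z hlt.1.ne', hq1 z hlt.2.ne'⟩

/-! ### Separability -/

theorem pow_le_pow_of_autLe {c d : Ω ≃o Ω} (h : autLe c d) (n : ℕ) : autLe (c ^ n) (d ^ n) := by
  induction n with
  | zero => exact fun x => le_rfl
  | succ n ih =>
    intro x
    rw [pow_succ', pow_succ']
    exact (c.monotone (ih x)).trans (h _)

theorem pow_le_pow_of_le {c : Ω ≃o Ω} (h : autLe 1 c) {m n : ℕ} (hmn : m ≤ n) :
    autLe (c ^ m) (c ^ n) := by
  intro x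
  obtain ⟨k, rfl⟩ := Nat.exists_eq_add_of_le' hmn
  rw [pow_add]
  have := pow_le_pow_of_autLe h k ((c ^ m) x)
  rwa [one_pow] at this

theorem exists_le_pow_apply [NoMinOrder Ω] [NoMaxOrder Ω] (hI : IntervalsSupport Ω)
    {c : Ω ≃o Ω} (hc : IsPos c) (hind : IsIndecomposable c) (hwu : IsWeakUnit c) (α β : Ω) :
    ∃ n : ℕ, β ≤ (c ^ n) α := by
  by_contra hβ
  set D : Set Ω := {x | ∃ n : ℕ, x ≤ (c ^ n) α}
  have hD : IsLowerSet D := fun x y hxy ⟨n, hn⟩ => ⟨n, hxy.trans hn⟩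
  have hcD : ∀ x, c x ∈ D ↔ x ∈ D := by
    intro x
    refine ⟨hD (hc.le_apply x), fun ⟨n, hn⟩ => ⟨n + 1, ?_⟩⟩
    rw [pow_succ']
    exact c.monotone hn
  obtain ⟨a, ha1, ha2⟩ := exists_splice hD (a := c) (b := 1) hcD (fun x => Iff.rfl)
  obtain ⟨b, hb1, hb2⟩ := exists_splice hD (a := 1) (b := c) (fun x => Iff.rfl) hcD
  have hsup : autSup a b = c := by
    ext x
    rw [autSup_apply]
    by_cases hx : x ∈ D
    · rw [ha1 x hx, hb1 x hx]; exact max_eq_left (hc.le_apply x)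
    · rw [ha2 x hx, hb2 x hx]; exact max_eq_right (hc.le_apply x)
  have hinf : autInf a b = 1 := by
    ext x
    rw [autInf_apply]
    by_cases hx : x ∈ D
    · rw [ha1 x hx, hb1 x hx]; exact min_eq_right (hc.le_apply x)
    · rw [ha2 x hx, hb2 x hx]; exact min_eq_left (hc.le_apply x)
  rcases hind a b hsup hinf with h1 | h1
  · obtain ⟨α', hα'⟩ := exists_lt α
    obtain ⟨h, hh, hsupp⟩ := hI α' α hα'
    refine hh.2 (hwu h hh.1 ((autInf_eq_one_iff hc.1 hh.1).2 fun x => ?_))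
    by_contra! hx
    have hxD : x ∈ D := ⟨0, (hsupp x hx.2).2.le⟩
    apply hx.1
    rw [← ha1 x hxD, h1]
    rfl
  · obtain ⟨γ, hγ⟩ := exists_gt β
    obtain ⟨h, hh, hsupp⟩ := hI β γ hγ
    refine hh.2 (hwu h hh.1 ((autInf_eq_one_iff hc.1 hh.1).2 fun x => ?_))
    by_contra! hx
    have hxD : x ∉ D := fun hxD => hβ (hD (hsupp x hx.2).1.le hxD)
    apply hx.1
    rw [← hb2 x hxD, h1]
    rfl

theorem exists_scale_sequence [NoMinOrder Ω] [NoMaxOrder Ω] (hI : IntervalsSupport Ω)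
    {f g : Ω ≃o Ω} (hfg : IsScalePair f g) (α : Ω) :
    ∃ s : ℕ → (Ω ≃o Ω), (∀ n, Centralizes f g (s n) ∧ IsPos (s n)) ∧
      ∀ c, Centralizes f g c → IsPos c → ∃ n, autLe (s n) c := by
  obtain ⟨hU, htot, hroot, hsmall⟩ := hfg
  obtain ⟨β, hβ⟩ := exists_gt α
  obtain ⟨h, hh, -⟩ := hI α β hβ
  obtain ⟨c₀, hc₀, hc₀', -⟩ := hsmall h hh
  choose d hd1 hd2 hd3 using hroot
  let s : ℕ → {c : Ω ≃o Ω // Centralizes f g c ∧ IsPos c} := fun n =>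
    Nat.rec ⟨c₀, hc₀, hc₀'⟩ (fun _ c => ⟨d c.1 c.2.1 c.2.2, hd1 _ _ _, hd2 _ _ _⟩) n
  have hs : ∀ n, autLe ((s (n + 1)).1 * (s (n + 1)).1) (s n).1 := fun n =>
    hd3 (s n).1 (s n).2.1 (s n).2.2
  have hpow : ∀ n, autLe ((s n).1 ^ 2 ^ n) c₀ := by
    intro n
    induction n with
    | zero => intro x; simp [s]
    | succ n ih =>
      intro x
      have h1 := pow_le_pow_of_autLe (hs n) (2 ^ n) x
      rw [← pow_two, ← pow_mul, ← pow_succ'] at h1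
      exact h1.trans (ih x)
  refine ⟨fun n => (s n).1, fun n => (s n).2, fun c hc hcp => ?_⟩
  by_contra! H
  obtain ⟨γ, hγ⟩ := exists_gt (c₀ α)
  obtain ⟨N, hN⟩ := exists_le_pow_apply hI hcp (hU c hc hcp).1 (hU c hc hcp).2 α γ
  have h1 : autLe c (s N).1 := (htot c hc (s N).1 (s N).2.1).resolve_right (H N)
  have h2 := pow_le_pow_of_le hcp.1 (Nat.lt_two_pow_self (n := N)).le α
  exact absurd ((hN.trans h2).trans
    ((pow_le_pow_of_autLe h1 (2 ^ N) α).trans (hpow N α))) hγ.not_ge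

theorem exists_dense_sequence [NoMinOrder Ω] [NoMaxOrder Ω] (hI : IntervalsSupport Ω)
    {f g : Ω ≃o Ω} (hfg : IsScalePair f g) (α : Ω) :
    ∃ Q : Set Ω, Q.Countable ∧ ∀ β γ : Ω, β < γ → ∃ q ∈ Q, β < q ∧ q < γ := by
  obtain ⟨s, hs, hsmall⟩ := exists_scale_sequence hI hfg α
  refine ⟨Set.range fun p : ℕ × ℕ × ℕ => (s p.1 ^ p.2.1) ((s p.1 ^ p.2.2)⁻¹ α),
    Set.countable_range _, fun β γ hβγ => ?_⟩
  obtain ⟨h, hh, hsupp⟩ := hI β γ hβγ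
  obtain ⟨c, hc, hcp, hhc⟩ := hfg.2.2.2 h hh
  have hcβ : c β < γ := by
    obtain ⟨x, hx⟩ := not_forall.1 hhc
    rw [not_le] at hx
    have hx' : h x ≠ x := ((hcp.le_apply x).trans_lt hx).ne'
    have hhx' : h (h x) ≠ h x := fun H => hx' (h.injective H)
    exact (c.strictMono (hsupp x hx').1).trans (hx.trans (hsupp _ hhx').2)
  obtain ⟨n, hn⟩ := hsmall c hc hcp
  have hU := hfg.1 (s n) (hs n).1 (hs n).2
  obtain ⟨b, hb⟩ := exists_le_pow_apply hI (hs n).2 hU.1 hU.2 β α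
  have hα' : (s n ^ b)⁻¹ α ≤ β := by
    have := (s n ^ b)⁻¹.monotone hb
    simpa using this
  have hex : ∃ N : ℕ, β < (s n ^ N) ((s n ^ b)⁻¹ α) := by
    obtain ⟨N, hN⟩ := exists_le_pow_apply hI (hs n).2 hU.1 hU.2 ((s n ^ b)⁻¹ α) γ
    exact ⟨N, hβγ.trans_le hN⟩
  classical
  obtain ⟨N, hN, hmin⟩ : ∃ N : ℕ, β < (s n ^ N) ((s n ^ b)⁻¹ α) ∧
      ∀ m < N, ¬ β < (s n ^ m) ((s n ^ b)⁻¹ α) :=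
    ⟨Nat.find hex, Nat.find_spec hex, fun m hm => Nat.find_min hex hm⟩
  refine ⟨_, ⟨(n, N, b), rfl⟩, hN, ?_⟩
  rcases N with _ | N
  · exact absurd hN (not_lt.2 hα')
  · have h1 := not_lt.1 (hmin N N.lt_succ_self)
    have h2 := (s n).monotone h1
    dsimp only
    rw [pow_succ']
    exact (h2.trans (hn β)).trans_lt hcβ

/-! ### Completeness -/

theorem exists_pos_cofinal_supp (hI : IntervalsSupport Ω) {Q : Set Ω} (hQ : Q.Countable)
    (hdense : ∀ β γ : Ω, β < γ → ∃ q ∈ Q, β < q ∧ q < γ) {D : Set Ω} (hD : IsLowerSet D)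
    (hne : D.Nonempty) (hnomax : ∀ x ∈ D, ∃ y ∈ D, x < y) :
    ∃ h : Ω ≃o Ω, IsPos h ∧ (∀ x, h x ≠ x → x ∈ D) ∧ ∀ x ∈ D, ∃ y, h y ≠ y ∧ x < y := by
  obtain ⟨x₀, hx₀⟩ := hne
  obtain ⟨x₁, hx₁, hx₀₁⟩ := hnomax x₀ hx₀
  obtain ⟨q₀, hq₀, -⟩ := hdense x₀ x₁ hx₀₁
  obtain ⟨q, rfl⟩ := hQ.exists_eq_range ⟨q₀, hq₀⟩
  have hstep : ∀ (n : ℕ) (x : D), ∃ y : D, x < y ∧ (q n ∈ D → q n < y) := by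
    intro n x
    by_cases hq : q n ∈ D
    · obtain ⟨y, hy, hxy⟩ := hnomax (max x (q n)) (by
        rcases max_choice (x : Ω) (q n) with h | h <;> rw [h]
        exacts [x.2, hq])
      rw [max_lt_iff] at hxy
      exact ⟨⟨y, hy⟩, hxy.1, fun _ => hxy.2⟩
    · obtain ⟨y, hy, hxy⟩ := hnomax x x.2
      exact ⟨⟨y, hy⟩, hxy, fun h => absurd h hq⟩
  choose next hnext1 hnext2 using hstep
  obtain ⟨x, hxs⟩ : ∃ x : ℕ → D, ∀ n, x (n + 1) = next n (x n) :=
    ⟨fun n => Nat.rec ⟨x₀, hx₀⟩ next n, fun n => rfl⟩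
  have hx : StrictMono x := strictMono_nat_of_lt_succ fun n => by
    rw [hxs]
    exact hnext1 n (x n)
  have hcof : ∀ d ∈ D, ∃ n : ℕ, d < (x n : Ω) := by
    intro d hd
    obtain ⟨d', hd', hlt⟩ := hnomax d hd
    obtain ⟨-, ⟨n, rfl⟩, h1, h2⟩ := hdense d d' hlt
    refine ⟨n + 1, h1.trans ?_⟩
    rw [hxs]
    exact hnext2 n (x n) (hD h2.le hd')
  choose k hk1 hk2 using fun n => hI (x n) (x (n + 1)) (hx n.lt_succ_self)
  have hfix : ∀ i n, k i (x n) = x n := by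
    intro i n
    by_contra hne
    obtain ⟨h1, h2⟩ := hk2 i _ hne
    have h3 : i < n := hx.lt_iff_lt.1 h1
    have h4 : n < i + 1 := hx.lt_iff_lt.1 h2
    omega
  obtain ⟨h, hh⟩ := exists_glue (m := fun y => {n : ℕ | (x n : Ω) < y})
    (fun y z hyz n hn => lt_of_lt_of_le hn hyz) (fun S => k (sSup S)) (fun S y => by
      ext n
      have := (k (sSup S)).lt_iff_lt (x := x n) (y := y)
      rw [hfix] at this
      exact this)
  have hval : ∀ n y, k n y ≠ y → h y = k n y := by
    intro n y hy
    obtain ⟨h1, h2⟩ := hk2 n y hy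
    have : {i : ℕ | (x i : Ω) < y} = Set.Iic n := by
      ext i
      constructor
      · intro hi
        have hi' : (x i : Ω) < x (n + 1) := lt_trans hi h2
        exact Nat.lt_succ_iff.1 (hx.lt_iff_lt.1 hi')
      · intro hi
        exact lt_of_le_of_lt (hx.monotone hi) h1
    rw [hh, this, csSup_Iic]
  have hcofsupp : ∀ d ∈ D, ∃ y, h y ≠ y ∧ d < y := by
    intro d hd
    obtain ⟨n, hn⟩ := hcof d hd
    obtain ⟨y, hy⟩ := exists_ne_of_ne_one (hk1 n).2
    exact ⟨y, by rwa [hval n y hy], hn.trans (hk2 n y hy).1⟩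
  obtain ⟨y, hy, -⟩ := hcofsupp x₀ hx₀
  refine ⟨h, isPos_of_le (fun z => ?_) hy, fun z hz => ?_, hcofsupp⟩
  · rw [hh]
    exact (hk1 _).le_apply z
  · rw [hh] at hz
    exact hD (hk2 _ z hz).2.le (x _).2

theorem exists_le_supp_of_above (htrans : ∀ α β : Ω, ∃ g : Ω ≃o Ω, g α = β)
    (hI : IntervalsSupport Ω) {a b : Ω ≃o Ω} (ha : IsPos a) (hb : IsPos b)
    (hab : ∀ p, IsPos p → Above p a → Above p b) {z : Ω} (hz : b z ≠ z) :
    ∃ y, a y ≠ y ∧ z ≤ y := by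
  by_contra! H
  obtain ⟨p, hp, hsupp⟩ := hI z (b z) (hb.lt_apply hz)
  obtain ⟨x, hx⟩ := exists_ne_of_ne_one hp.2
  have h1 : Above p a := (above_iff htrans hp ha).2 fun x y hx hy =>
    (H y hy).trans (hsupp x hx).1
  have h2 := (above_iff htrans hp hb).1 (hab p hp h1) x (b z) hx
    fun h => hz (b.injective h)
  exact lt_asymm h2 (hsupp x hx).2

theorem exists_isLUB_of_cutsConjugate [NoMinOrder Ω] [NoMaxOrder Ω]
    (htrans : ∀ α β : Ω, ∃ g : Ω ≃o Ω, g α = β)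
    (hI : IntervalsSupport Ω) {Q : Set Ω} (hQ : Q.Countable)
    (hdense : ∀ β γ : Ω, β < γ → ∃ q ∈ Q, β < q ∧ q < γ) (hcut : CutsConjugate Ω)
    {S : Set Ω} (hS : S.Nonempty) (hbdd : BddAbove S) : ∃ a, IsLUB S a := by
  obtain ⟨α, hα⟩ := hS
  obtain ⟨b, hb⟩ := hbdd
  have hbounded : ∀ {h : Ω ≃o Ω} {δ : Ω}, IsPos h → (∀ x, h x ≠ x → x < δ) →
      ∃ p, IsPos p ∧ Above p h := by
    intro h δ hh hδ
    obtain ⟨δ', hδ'⟩ := exists_gt δ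
    obtain ⟨p, hp, hsupp⟩ := hI δ δ' hδ'
    exact ⟨p, hp, (above_iff htrans hp hh).2 fun x y hx hy => (hδ y hy).trans (hsupp x hx).1⟩
  have hdense' : ∀ x y : Ω, x < y → ∃ z, x < z ∧ z < y := fun x y hxy => by
    obtain ⟨z, -, hz⟩ := hdense x y hxy
    exact ⟨z, hz⟩
  obtain ⟨h₁, hp₁, hsub₁, hcof₁⟩ := exists_pos_cofinal_supp hI hQ hdense (isLowerSet_Iio α)
    (exists_lt α) (fun x hx => by
      obtain ⟨z, hxz, hz⟩ := hdense' x α hx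
      exact ⟨z, hz, hxz⟩)
  obtain ⟨h₂, hp₂, hsub₂, hcof₂⟩ := exists_pos_cofinal_supp hI hQ hdense
    (D := {x | ∃ s ∈ S, x < s})
    (fun x y hxy ⟨s, hs, hxs⟩ => ⟨s, hs, hxy.trans_lt hxs⟩)
    (by obtain ⟨x, hx⟩ := exists_lt α; exact ⟨x, α, hα, hx⟩)
    (fun x ⟨s, hs, hxs⟩ => by
      obtain ⟨z, hxz, hz⟩ := hdense' x s hxs
      exact ⟨z, ⟨s, hs, hz⟩, hxz⟩)
  obtain ⟨k, a', hka, hiff⟩ := hcut h₁ h₂ hp₁ hp₂ (hbounded hp₁ hsub₁)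
    (hbounded (δ := b) hp₂ fun x hx => by
      obtain ⟨s, hs, hxs⟩ := hsub₂ x hx
      exact hxs.trans_le (hb hs))
  obtain rfl : a' = k * h₁ * k⁻¹ := by rw [hka]; group
  have hD : ∀ x, (∃ s ∈ S, x < s) ↔ x < k α := by
    intro x
    constructor
    · intro hx
      obtain ⟨z, hz, hxz⟩ := hcof₂ x hx
      obtain ⟨y, hy, hzy⟩ := exists_le_supp_of_above htrans hI (hp₁.conj k) hp₂
        (fun p hp => (hiff p hp).1) hz
      have h3 := k.strictMono (hsub₁ _ (conj_apply_ne_iff.1 hy))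
      rw [RelIso.apply_inv_self] at h3
      exact (hxz.trans_le hzy).trans h3
    · intro hx
      have hx' : k⁻¹ x < α := by simpa using k⁻¹.strictMono hx
      obtain ⟨z, hz, hxz⟩ := hcof₁ _ hx'
      have hz' : (k * h₁ * k⁻¹) (k z) ≠ k z := conj_apply_ne_iff.2 (by simpa using hz)
      obtain ⟨y, hy, hzy⟩ := exists_le_supp_of_above htrans hI hp₂ (hp₁.conj k)
        (fun p hp => (hiff p hp).2) hz'
      obtain ⟨s, hs, hys⟩ := hsub₂ y hy
      have h3 := k.strictMono hxz
      rw [RelIso.apply_inv_self] at h3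
      exact ⟨s, hs, (h3.trans_le hzy).trans hys⟩
  refine ⟨k α, fun s hs => ?_, fun c hc => ?_⟩
  · by_contra! hlt
    exact lt_irrefl _ ((hD _).1 ⟨s, hs, hlt⟩)
  · by_contra! hlt
    obtain ⟨s, hs, hcs⟩ := (hD _).2 hlt
    exact absurd (hc hs) hcs.not_ge

/-! ### The order type of the real line -/

theorem nonempty_orderIso_real [Nonempty Ω] [NoMinOrder Ω] [NoMaxOrder Ω] {Q : Set Ω}
    (hQ : Q.Countable) (hdense : ∀ β γ : Ω, β < γ → ∃ q ∈ Q, β < q ∧ q < γ)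
    (hcomplete : ∀ S : Set Ω, S.Nonempty → BddAbove S → ∃ a, IsLUB S a) :
    Nonempty (Ω ≃o ℝ) := by
  have hlt : ∀ x : Ω, ∃ q : Q, (q : Ω) < x := fun x => by
    obtain ⟨y, hy⟩ := exists_lt x
    obtain ⟨q, hq, -, h⟩ := hdense y x hy
    exact ⟨⟨q, hq⟩, h⟩
  have hgt : ∀ x : Ω, ∃ q : Q, x < (q : Ω) := fun x => by
    obtain ⟨y, hy⟩ := exists_gt x
    obtain ⟨q, hq, h, -⟩ := hdense x y hy
    exact ⟨⟨q, hq⟩, h⟩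
  have : Countable Q := hQ
  have : Nonempty Q := by
    obtain ⟨q, -⟩ := hlt (Classical.arbitrary Ω)
    exact ⟨q⟩
  have : DenselyOrdered Q := ⟨fun a b hab => by
    obtain ⟨q, hq, h1, h2⟩ := hdense a b hab
    exact ⟨⟨q, hq⟩, h1, h2⟩⟩
  have : NoMinOrder Q := ⟨fun a => hlt a⟩
  have : NoMaxOrder Q := ⟨fun a => hgt a⟩
  obtain ⟨e⟩ := Order.iso_of_countable_dense Q ℚ
  have hbdd : ∀ x : Ω, BddAbove {r : ℝ | ∃ q : Q, (q : Ω) < x ∧ r = e q} := fun x => by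
    obtain ⟨p, hp⟩ := hgt x
    refine ⟨e p, ?_⟩
    rintro _ ⟨q, hq, rfl⟩
    exact_mod_cast e.monotone (show q ≤ p from (hq.trans hp).le)
  let φ : Ω → ℝ := fun x => sSup {r : ℝ | ∃ q : Q, (q : Ω) < x ∧ r = e q}
  have hφ1 : ∀ (x : Ω) (q : Q), x ≤ q → φ x ≤ e q := by
    intro x q hq
    obtain ⟨p, hp⟩ := hlt x
    refine csSup_le ⟨_, p, hp, rfl⟩ ?_
    rintro _ ⟨p, hp, rfl⟩
    exact_mod_cast e.monotone (show p ≤ q from (hp.trans_le hq).le)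
  have hφ2 : ∀ (x : Ω) (q : Q), (q : Ω) < x → (e q : ℝ) < φ x := by
    intro x q hq
    obtain ⟨p, hp, h1, h2⟩ := hdense q x hq
    have h3 : (e q : ℝ) < e ⟨p, hp⟩ := by
      exact_mod_cast e.strictMono (show q < ⟨p, hp⟩ from h1)
    exact h3.trans_le (le_csSup (hbdd x) ⟨⟨p, hp⟩, h2, rfl⟩)
  have hmono : StrictMono φ := by
    intro x y hxy
    obtain ⟨q, hq, h1, h2⟩ := hdense x y hxy
    exact (hφ1 x ⟨q, hq⟩ h1.le).trans_lt (hφ2 y ⟨q, hq⟩ h2)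
  have hsurj : Function.Surjective φ := by
    intro r
    obtain ⟨a, ha⟩ := hcomplete {x | ∃ q : Q, (e q : ℝ) < r ∧ (q : Ω) = x}
      (by
        obtain ⟨t, ht⟩ := exists_rat_lt r
        exact ⟨_, e.symm t, by simpa using ht, rfl⟩)
      (by
        obtain ⟨t, ht⟩ := exists_rat_gt r
        refine ⟨e.symm t, ?_⟩
        rintro _ ⟨q, hq, rfl⟩
        have : e q < t := by exact_mod_cast hq.trans ht
        have : q < e.symm t := by rwa [OrderIso.lt_symm_apply]
        exact this.le)
    have key : ∀ q : Q, (e q : ℝ) < r ↔ (q : Ω) < a := by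
      intro q
      constructor
      · intro hq
        obtain ⟨t, h1, h2⟩ := exists_rat_btwn hq
        have h3 : q < e.symm t := by
          rw [OrderIso.lt_symm_apply]; exact_mod_cast h1
        exact lt_of_lt_of_le (show (q : Ω) < e.symm t from h3)
          (ha.1 ⟨e.symm t, by simpa using h2, rfl⟩)
      · intro hq
        obtain ⟨_, ⟨p, hp, rfl⟩, h1⟩ := (lt_isLUB_iff ha).1 hq
        have : (e q : ℝ) < e p := by exact_mod_cast e.strictMono (show q < p from h1)
        exact this.trans hp
    refine ⟨a, le_antisymm (le_of_forall_rat_lt_imp_le fun t ht => ?_)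
      (le_of_forall_rat_lt_imp_le fun t ht => ?_)⟩
    · by_contra! h
      have h1 := hφ1 a (e.symm t) (not_lt.1 fun h' => by
        have := (key _).2 h'
        rw [OrderIso.apply_symm_apply] at this
        exact lt_asymm h this)
      rw [OrderIso.apply_symm_apply] at h1
      exact absurd h1 ht.not_ge
    · have := hφ2 a (e.symm t) ((key _).1 (by simpa using ht))
      rw [OrderIso.apply_symm_apply] at this
      exact this.le
  exact ⟨hmono.orderIsoOfSurjective φ hsurj⟩

theorem orderIso_real_of_properties (htrans : ∀ α β : Ω, ∃ g : Ω ≃o Ω, g α = β)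
    (hsplit : HasSplitting Ω) (hscale : ∃ f g : Ω ≃o Ω, IsScalePair f g)
    (hcut : CutsConjugate Ω) (hpos : ∃ h : Ω ≃o Ω, IsPos h) : Nonempty (Ω ≃o ℝ) := by
  obtain ⟨h, hh⟩ := hpos
  obtain ⟨x, hx⟩ := exists_ne_of_ne_one hh.2
  have hlt := hh.lt_apply hx
  have : Nonempty Ω := ⟨x⟩
  have : NoMaxOrder Ω := ⟨fun y => by
    obtain ⟨g, rfl⟩ := htrans x y
    exact ⟨g (h x), g.strictMono hlt⟩⟩
  have : NoMinOrder Ω := ⟨fun y => by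
    obtain ⟨g, rfl⟩ := htrans (h x) y
    exact ⟨g x, g.strictMono hlt⟩⟩
  have hI := intervalsSupport htrans hsplit
  obtain ⟨f, g, hfg⟩ := hscale
  obtain ⟨Q, hQ, hdense⟩ := exists_dense_sequence hI hfg x
  exact nonempty_orderIso_real hQ hdense fun S hS hb =>
    exists_isLUB_of_cutsConjugate htrans hI hQ hdense hcut hS hb

/-! ### The properties hold on the real line -/

theorem real_transitive (α β : ℝ) : ∃ g : ℝ ≃o ℝ, g α = β :=
  ⟨OrderIso.addRight (β - α), by simp⟩

/-- Scaling by `t > 0` about `a`. -/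
theorem exists_real_homothety (a : ℝ) {t : ℝ} (ht : 0 < t) :
    ∃ s : ℝ ≃o ℝ, ∀ x, s x = (x - a) * t + a :=
  ⟨(OrderIso.addRight (-a)).trans ((OrderIso.mulRight₀ t ht).trans (OrderIso.addRight a)),
    fun x => by simp [sub_eq_add_neg]⟩

theorem intervalsSupport_real : IntervalsSupport ℝ := by
  intro a b hab
  obtain ⟨s, hs⟩ := exists_real_homothety a (t := 2) (by norm_num)
  obtain ⟨t, ht⟩ := exists_real_homothety b (t := 1 / 2) (by norm_num)
  have hka : autInf s t a = a := by
    rw [autInf_apply, hs, ht, min_eq_left (by linarith)]; ring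
  have hkb : autInf s t b = b := by
    rw [autInf_apply, hs, ht, min_eq_right (by linarith)]; ring
  have hfix : ∀ {k : ℝ ≃o ℝ} {c : ℝ}, k c = c → ∀ x, k x ∈ Set.Iio c ↔ x ∈ Set.Iio c := by
    intro k c hk x
    conv_lhs => rw [← hk]
    simp
  obtain ⟨k, hk1, hk2⟩ := exists_splice (isLowerSet_Iio a) (a := 1) (b := autInf s t)
    (fun x => Iff.rfl) (hfix hka)
  have hkb' : k b = b := by rw [hk2 b hab.not_gt, hkb]
  obtain ⟨h, h1, h2⟩ := exists_splice (isLowerSet_Iio b) (a := k) (b := 1)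
    (hfix hkb') (fun x => Iff.rfl)
  have hlt : ∀ x, a < x → x < b → x < h x := by
    intro x hax hxb
    rw [h1 x hxb, hk2 x hax.not_gt, autInf_apply, hs, ht, lt_min_iff]
    constructor <;> linarith
  have hout : ∀ x, ¬ (a < x ∧ x < b) → h x = x := by
    intro x hx
    by_cases hxb : x < b
    · rw [h1 x hxb]
      rcases (not_lt.1 fun h => hx ⟨h, hxb⟩).lt_or_eq with hxa | rfl
      · exact hk1 x hxa
      · rw [hk2 x (lt_irrefl x), hka]
    · exact h2 x hxb
  refine ⟨h, isPos_of_le (x := (a + b) / 2) (fun x => ?_)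
    (hlt _ (by linarith) (by linarith)).ne', fun x hx => by_contra fun H => hx (hout x H)⟩
  by_cases hx : a < x ∧ x < b
  · exact (hlt x hx.1 hx.2).le
  · exact (hout x hx).ge

theorem hasSplitting_real : HasSplitting ℝ := by
  intro h hh
  obtain ⟨x₀, hx₀⟩ := exists_ne_of_ne_one hh.2
  obtain ⟨m, hm1, hm2⟩ := exists_between (hh.lt_apply hx₀)
  obtain ⟨p, hp, hps⟩ := intervalsSupport_real _ _ hm2
  obtain ⟨q, hq, hqs⟩ := intervalsSupport_real _ _ hm1
  have hle : ∀ r : ℝ ≃o ℝ, (∀ x, r x ≠ x → x₀ < x ∧ x < h x₀) → autLe r h := by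
    intro r hr x
    by_cases hx : r x = x
    · rw [hx]; exact hh.le_apply x
    · exact ((hr (r x) fun H => hx (r.injective H)).2.trans (h.strictMono (hr x hx).1)).le
  exact ⟨p, q, hp, hq, hle p fun x hx => ⟨hm1.trans (hps x hx).1, (hps x hx).2⟩,
    hle q fun x hx => ⟨(hqs x hx).1, (hqs x hx).2.trans hm2⟩,
    (above_iff real_transitive hp hq).2 fun x y hx hy => (hqs y hy).2.trans (hps x hx).1⟩

theorem apply_eq_add_of_centralizes {c : ℝ ≃o ℝ}
    (hc : Centralizes (OrderIso.addRight √2) (OrderIso.addRight (1 : ℝ)) c) (x : ℝ) :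
    c x = x + c 0 := by
  have h1 : ∀ y, c (y + √2) = c y + √2 := fun y => DFunLike.congr_fun hc.1 y
  have h2 : ∀ y, c (y + 1) = c y + 1 := fun y => DFunLike.congr_fun hc.2 y
  have hper : ∀ t ∈ AddSubgroup.closure {√2, (1 : ℝ)}, ∀ y, c (y + t) = c y + t := by
    intro t ht
    induction ht using AddSubgroup.closure_induction with
    | mem t ht =>
      rcases ht with rfl | rfl
      exacts [h1, h2]
    | zero => simp
    | add s t _ _ hs ht => intro y; rw [← add_assoc, ht, hs, add_assoc]
    | neg t _ ht =>
      intro y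
      have := ht (y + -t)
      rw [neg_add_cancel_right] at this
      rw [this, add_neg_cancel_right]
  have hdense : Dense (AddSubgroup.closure {√2, (1 : ℝ)} : Set ℝ) :=
    dense_addSubgroupClosure_pair_iff.2 (by simpa using irrational_sqrt_two)
  refine congrFun (Continuous.ext_on hdense c.continuous
    (continuous_id.add continuous_const) fun t ht => ?_) x
  have := hper t ht 0
  rw [zero_add] at this
  rw [this, add_comm]
  rfl

theorem isScalePair_real :
    IsScalePair (OrderIso.addRight √2) (OrderIso.addRight (1 : ℝ)) := by
  have hcen : ∀ t : ℝ, Centralizes (OrderIso.addRight √2) (OrderIso.addRight (1 : ℝ))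
      (OrderIso.addRight t) := fun t =>
    ⟨by ext x; exact add_right_comm x _ _, by ext x; exact add_right_comm x _ _⟩
  have hpos : ∀ t : ℝ, 0 < t → IsPos (OrderIso.addRight t) := fun t ht =>
    isPos_of_le (x := 0) (fun x => by simpa using ht.le) (by simpa using ht.ne')
  have hpos' : ∀ c : ℝ ≃o ℝ, (∀ x, c x = x + c 0) → IsPos c → 0 < c 0 := by
    intro c hc hcp
    obtain ⟨x, hx⟩ := exists_ne_of_ne_one hcp.2
    have := hcp.lt_apply hx
    rw [hc] at this
    linarith
  refine ⟨fun c hc hcp => ?_, fun c hc d hd => ?_, fun c hc hcp => ?_, fun h hh => ?_⟩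
  · have happ := apply_eq_add_of_centralizes hc
    have h0 := hpos' c happ hcp
    refine ⟨fun a b hsup hinf => ?_, fun h hh hinf => ?_⟩
    · have hmax : ∀ x, max (a x) (b x) = x + c 0 := fun x => by
        rw [← happ, ← autSup_apply, hsup]
      have hmin : ∀ x, min (a x) (b x) = x := fun x => by
        rw [← autInf_apply, hinf]; rfl
      have hcompl : {x | a x = x} = {x | b x = x}ᶜ := by
        ext x
        have h1 := hmax x
        have h2 := hmin x
        simp only [Set.mem_ofPred_eq, Set.mem_compl_iff]
        constructor
        · intro ha hb
          rw [ha, hb, max_self] at h1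
          linarith
        · intro hb
          rcases min_choice (a x) (b x) with h3 | h3
          · rw [← h3, h2]
          · exact absurd (h3.symm.trans h2) hb
      have hclopen : IsClopen {x | a x = x} := by
        refine ⟨isClosed_eq a.continuous continuous_id, ?_⟩
        rw [hcompl]
        exact (isClosed_eq b.continuous continuous_id).isOpen_compl
      rcases isClopen_iff.1 hclopen with h | h
      · right
        ext x
        by_contra hx
        have : x ∈ {x | a x = x} := by rw [hcompl]; exact hx
        rw [h] at this
        exact this
      · left
        ext x
        exact Set.eq_univ_iff_forall.1 h x
    · ext x
      refine ((autInf_eq_one_iff hcp.1 hh).1 hinf x).resolve_left ?_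
      rw [happ]
      linarith
  · rcases le_total (c 0) (d 0) with h | h
    · left
      intro x
      rw [apply_eq_add_of_centralizes hc, apply_eq_add_of_centralizes hd]
      linarith
    · right
      intro x
      rw [apply_eq_add_of_centralizes hc, apply_eq_add_of_centralizes hd]
      linarith
  · have happ := apply_eq_add_of_centralizes hc
    have h0 := hpos' c happ hcp
    refine ⟨_, hcen (c 0 / 2), hpos _ (by linarith), fun x => ?_⟩
    rw [happ x, RelIso.mul_apply, OrderIso.addRight_apply, OrderIso.addRight_apply]
    linarith
  · obtain ⟨x, hx⟩ := exists_ne_of_ne_one hh.2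
    have h1 := hh.lt_apply hx
    refine ⟨_, hcen ((h x - x) / 2), hpos _ (by linarith), fun H => ?_⟩
    have := H x
    rw [OrderIso.addRight_apply] at this
    linarith

theorem above_iff_of_isLUB (htrans : ∀ α β : Ω, ∃ g : Ω ≃o Ω, g α = β) {p h : Ω ≃o Ω}
    (hp : IsPos p) (hh : IsPos h) {s : Ω} (hs : IsLUB {y | h y ≠ y} s) :
    Above p h ↔ ∀ x, p x ≠ x → s ≤ x := by
  rw [above_iff htrans hp hh]
  refine forall_congr' fun x => ⟨fun H hx => hs.2 fun y hy => (H y hx hy).le,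
    fun H y hx hy => ?_⟩
  exact ((hh.lt_apply hy).trans_le (hs.1 fun h' => hy (h.injective h'))).trans_le (H hx)

theorem cutsConjugate_real : CutsConjugate ℝ := by
  have hlub : ∀ a : ℝ ≃o ℝ, IsPos a → (∃ p, IsPos p ∧ Above p a) →
      ∃ s, IsLUB {y | a y ≠ y} s := by
    rintro a ha ⟨p, hp, hpa⟩
    obtain ⟨x, hx⟩ := exists_ne_of_ne_one hp.2
    exact Real.exists_isLUB (exists_ne_of_ne_one ha.2)
      ⟨x, fun y hy => ((above_iff real_transitive hp ha).1 hpa x y hx hy).le⟩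
  intro a b ha hb ha' hb'
  obtain ⟨s, hs⟩ := hlub a ha ha'
  obtain ⟨t, ht⟩ := hlub b hb hb'
  obtain ⟨k, hk⟩ := real_transitive s t
  have hs' : IsLUB {y | (k * a * k⁻¹) y ≠ y} t := by
    have himage : {y | (k * a * k⁻¹) y ≠ y} = k '' {y | a y ≠ y} := ?_
    · rw [himage, ← hk]
      exact k.isLUB_image'.2 hs
    ext y
    rw [Set.mem_ofPred_eq, conj_apply_ne_iff]
    constructor
    · intro hy
      exact ⟨_, hy, by simp⟩
    · rintro ⟨z, hz, rfl⟩
      simpa using hz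
  refine ⟨k, k * a * k⁻¹, by group, fun p hp => ?_⟩
  rw [above_iff_of_isLUB real_transitive hp (ha.conj k) hs',
    above_iff_of_isLUB real_transitive hp hb ht]

/-! ### Formalizing the properties in the language of lattice-ordered groups -/

open FirstOrder Language

/-- Terms with `n` bound variables. -/
abbrev Tm (n : ℕ) : Type := LGLang.Term (Empty ⊕ Fin n)

/-- Formulas with `n` bound variables. -/
abbrev Fm (n : ℕ) : Type := LGLang.BoundedFormula Empty n

/-- The `i`-th bound variable. -/
def tVar {n : ℕ} (i : Fin n) : Tm n := Term.var (Sum.inr i)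

/-- Product of terms. -/
def tMul {n : ℕ} (s t : Tm n) : Tm n :=
  Term.func (L := LGLang) (l := 2) LGFunc.mul ![s, t]

/-- Inverse of a term. -/
def tInv {n : ℕ} (s : Tm n) : Tm n := Term.func (L := LGLang) (l := 1) LGFunc.inv ![s]

/-- The identity term. -/
def tOne {n : ℕ} : Tm n := Term.func (L := LGLang) (l := 0) LGFunc.one ![]

/-- Join of terms. -/
def tSup {n : ℕ} (s t : Tm n) : Tm n :=
  Term.func (L := LGLang) (l := 2) LGFunc.join ![s, t]

/-- Meet of terms. -/
def tInf {n : ℕ} (s t : Tm n) : Tm n :=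
  Term.func (L := LGLang) (l := 2) LGFunc.meet ![s, t]

/-- The value of a term. -/
noncomputable def tVal {n : ℕ} (v : Fin n → (Ω ≃o Ω)) (t : Tm n) : Ω ≃o Ω :=
  t.realize (Sum.elim (default : Empty → (Ω ≃o Ω)) v)

section Values

variable {n : ℕ} (v : Fin n → (Ω ≃o Ω)) (i : Fin n) (s t : Tm n)

@[simp] theorem tVal_tVar : tVal v (tVar i) = v i := rfl

@[simp] theorem tVal_tMul : tVal v (tMul s t) = tVal v s * tVal v t := rfl

@[simp] theorem tVal_tInv : tVal v (tInv s) = (tVal v s)⁻¹ := rfl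

@[simp] theorem tVal_tOne : tVal v tOne = 1 := rfl

@[simp] theorem tVal_tSup : tVal v (tSup s t) = autSup (tVal v s) (tVal v t) := rfl

@[simp] theorem tVal_tInf : tVal v (tInf s t) = autInf (tVal v s) (tVal v t) := rfl

end Values

/-- Satisfaction of a formula. -/
def Sat {n : ℕ} (v : Fin n → (Ω ≃o Ω)) (φ : Fm n) : Prop := φ.Realize default v

/-- Equality of terms. -/
def fEq {n : ℕ} (s t : Tm n) : Fm n := s.bdEqual t

/-- The order relation between terms. -/
def fLe {n : ℕ} (s t : Tm n) : Fm n := fEq (tSup s t) t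

section Satisfaction

variable {n : ℕ} (v : Fin n → (Ω ≃o Ω))

@[simp] theorem sat_fEq (s t : Tm n) : Sat v (fEq s t) ↔ tVal v s = tVal v t :=
  BoundedFormula.realize_bdEqual s t

@[simp] theorem sat_fLe (s t : Tm n) : Sat v (fLe s t) ↔ autLe (tVal v s) (tVal v t) := by
  rw [fLe, sat_fEq, tVal_tSup, autSup_eq_right_iff]

@[simp] theorem sat_not (φ : Fm n) : Sat v (∼φ) ↔ ¬ Sat v φ := BoundedFormula.realize_not

@[simp] theorem sat_inf (φ ψ : Fm n) : Sat v (φ ⊓ ψ) ↔ Sat v φ ∧ Sat v ψ :=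
  BoundedFormula.realize_inf

@[simp] theorem sat_sup (φ ψ : Fm n) : Sat v (φ ⊔ ψ) ↔ Sat v φ ∨ Sat v ψ :=
  BoundedFormula.realize_sup

@[simp] theorem sat_imp (φ ψ : Fm n) : Sat v (φ ⟹ ψ) ↔ (Sat v φ → Sat v ψ) :=
  BoundedFormula.realize_imp

@[simp] theorem sat_iff (φ ψ : Fm n) : Sat v (φ.iff ψ) ↔ (Sat v φ ↔ Sat v ψ) :=
  BoundedFormula.realize_iff

@[simp] theorem sat_all (φ : Fm (n + 1)) :
    Sat v (∀'φ) ↔ ∀ a, Sat (Fin.snoc v a : Fin (n + 1) → (Ω ≃o Ω)) φ :=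
  BoundedFormula.realize_all

@[simp] theorem sat_ex (φ : Fm (n + 1)) :
    Sat v (∃'φ) ↔ ∃ a, Sat (Fin.snoc v a : Fin (n + 1) → (Ω ≃o Ω)) φ :=
  BoundedFormula.realize_ex

end Satisfaction

/-- The formula expressing `IsPos`. -/
def fPos {n : ℕ} (i : Fin n) : Fm n := fLe tOne (tVar i) ⊓ ∼(fEq (tVar i) tOne)

/-- The formula expressing `Above`. -/
def fAbove {n : ℕ} (i j : Fin n) : Fm n :=
  ∀'(fLe tOne (tVar (Fin.last n)) ⟹
    fEq (tInf (tMul (tMul (tVar (Fin.last n)) (tVar i.castSucc)) (tInv (tVar (Fin.last n))))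
      (tVar j.castSucc)) tOne)

/-- The formula expressing `IsIndecomposable`. -/
def fIndecomposable {n : ℕ} (i : Fin n) : Fm n :=
  ∀' ∀'(fEq (tSup (tVar (Fin.last n).castSucc) (tVar (Fin.last (n + 1))))
      (tVar i.castSucc.castSucc) ⟹
    (fEq (tInf (tVar (Fin.last n).castSucc) (tVar (Fin.last (n + 1)))) tOne ⟹
      (fEq (tVar (Fin.last n).castSucc) tOne ⊔ fEq (tVar (Fin.last (n + 1))) tOne)))

/-- The formula expressing `IsWeakUnit`. -/
def fWeakUnit {n : ℕ} (i : Fin n) : Fm n :=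
  ∀'(fLe tOne (tVar (Fin.last n)) ⟹
    (fEq (tInf (tVar i.castSucc) (tVar (Fin.last n))) tOne ⟹
      fEq (tVar (Fin.last n)) tOne))

/-- The formula expressing `Centralizes`. -/
def fCentralizes {n : ℕ} (i j k : Fin n) : Fm n :=
  fEq (tMul (tVar k) (tVar i)) (tMul (tVar i) (tVar k)) ⊓
    fEq (tMul (tVar k) (tVar j)) (tMul (tVar j) (tVar k))

section Satisfaction

variable {n : ℕ} (v : Fin n → (Ω ≃o Ω)) (i j k : Fin n)

@[simp] theorem sat_fPos : Sat v (fPos i) ↔ IsPos (v i) := by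
  simp [fPos, IsPos]

@[simp] theorem sat_fAbove : Sat v (fAbove i j) ↔ Above (v i) (v j) := by
  simp [fAbove, Above]

@[simp] theorem sat_fIndecomposable :
    Sat v (fIndecomposable i) ↔ IsIndecomposable (v i) := by
  simp [fIndecomposable, IsIndecomposable]

@[simp] theorem sat_fWeakUnit : Sat v (fWeakUnit i) ↔ IsWeakUnit (v i) := by
  simp [fWeakUnit, IsWeakUnit]

@[simp] theorem sat_fCentralizes :
    Sat v (fCentralizes i j k) ↔ Centralizes (v i) (v j) (v k) := by
  simp [fCentralizes, Centralizes]

end Satisfaction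

/-- The sentence expressing `HasSplitting`. -/
def splittingSentence : Fm 0 :=
  ∀'(fPos 0 ⟹ ∃' ∃'(fPos 1 ⊓ (fPos 2 ⊓ (fLe (tVar 1) (tVar 0) ⊓
    (fLe (tVar 2) (tVar 0) ⊓ fAbove 1 2)))))

/-- The sentence asserting the existence of a pair satisfying `IsScalePair`. -/
def scaleSentence : Fm 0 :=
  ∃' ∃'((∀'(fCentralizes 0 1 2 ⟹ (fPos 2 ⟹ (fIndecomposable 2 ⊓ fWeakUnit 2)))) ⊓
    ((∀'(fCentralizes 0 1 2 ⟹ ∀'(fCentralizes 0 1 3 ⟹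
      (fLe (tVar 2) (tVar 3) ⊔ fLe (tVar 3) (tVar 2))))) ⊓
    ((∀'(fCentralizes 0 1 2 ⟹ (fPos 2 ⟹ ∃'(fCentralizes 0 1 3 ⊓ (fPos 3 ⊓
      fLe (tMul (tVar 3) (tVar 3)) (tVar 2)))))) ⊓
    ∀'(fPos 2 ⟹ ∃'(fCentralizes 0 1 3 ⊓ (fPos 3 ⊓ ∼(fLe (tVar 2) (tVar 3))))))))

/-- The sentence expressing `CutsConjugate`. -/
def cutsSentence : Fm 0 :=
  ∀' ∀'(fPos 0 ⟹ (fPos 1 ⟹ ((∃'(fPos 2 ⊓ fAbove 2 0)) ⟹ ((∃'(fPos 2 ⊓ fAbove 2 1)) ⟹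
    ∃' ∃'(fEq (tMul (tVar 2) (tVar 0)) (tMul (tVar 3) (tVar 2)) ⊓
      ∀'(fPos 4 ⟹ (fAbove 4 3).iff (fAbove 4 1)))))))

/-- The sentence asserting that a positive element exists. -/
def posSentence : Fm 0 := ∃'(fPos 0)

theorem sat_splittingSentence {v : Fin 0 → (Ω ≃o Ω)} :
    Sat v splittingSentence ↔ HasSplitting Ω := by
  simp only [splittingSentence, sat_all, sat_ex, sat_imp, sat_inf, sat_fPos, sat_fLe,
    sat_fAbove, tVal_tVar]
  rfl

theorem sat_scaleSentence {v : Fin 0 → (Ω ≃o Ω)} :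
    Sat v scaleSentence ↔ ∃ f g : Ω ≃o Ω, IsScalePair f g := by
  simp only [scaleSentence, sat_all, sat_ex, sat_imp, sat_inf, sat_sup, sat_not, sat_fPos,
    sat_fLe, sat_fCentralizes, sat_fIndecomposable, sat_fWeakUnit, tVal_tVar, tVal_tMul]
  rfl

theorem sat_cutsSentence {v : Fin 0 → (Ω ≃o Ω)} :
    Sat v cutsSentence ↔ CutsConjugate Ω := by
  simp only [cutsSentence, sat_all, sat_ex, sat_imp, sat_inf, sat_iff, sat_fPos, sat_fEq,
    sat_fAbove, tVal_tVar, tVal_tMul]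
  rfl

theorem sat_posSentence {v : Fin 0 → (Ω ≃o Ω)} :
    Sat v posSentence ↔ ∃ h : Ω ≃o Ω, IsPos h := by
  simp only [posSentence, sat_ex, sat_fPos]
  rfl

theorem sat_iff_realize {v : Fin 0 → (Ω ≃o Ω)} (φ : Fm 0) :
    Sat v φ ↔ Sentence.Realize (Ω ≃o Ω) φ := by
  rw [Sat, Sentence.Realize, Formula.Realize]
  exact iff_of_eq (congrArg₂ _ (Subsingleton.elim _ _) (Subsingleton.elim _ _))

theorem sat_iff_of_elementarilyEquivalent {Ω' : Type*} [LinearOrder Ω']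
    (heq : LGLang.ElementarilyEquivalent (Ω ≃o Ω) (Ω' ≃o Ω')) (φ : Fm 0) :
    Sat (Fin.elim0 : Fin 0 → (Ω ≃o Ω)) φ ↔ Sat (Fin.elim0 : Fin 0 → (Ω' ≃o Ω')) φ := by
  rw [sat_iff_realize, sat_iff_realize]
  exact elementarilyEquivalent_iff.1 heq φ

/-- If `Aut(Ω,≤)` acts transitively on `Ω` and is elementarily
equivalent to `Aut(ℝ,≤)` in the first-order language of lattice-ordered groups,
then `Ω ≅ ℝ` as ordered sets. -/
theorem elem_equiv_real (Ω : Type*) [LinearOrder Ω]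
    (htrans : ∀ α β : Ω, ∃ g : Ω ≃o Ω, g α = β)
    (heq : LGLang.ElementarilyEquivalent (Ω ≃o Ω) (ℝ ≃o ℝ)) :
    Nonempty (Ω ≃o ℝ) := by
  have key := sat_iff_of_elementarilyEquivalent heq
  refine orderIso_real_of_properties htrans
    (sat_splittingSentence.1 ((key _).2 (sat_splittingSentence.2 hasSplitting_real)))
    (sat_scaleSentence.1 ((key _).2 (sat_scaleSentence.2 ⟨_, _, isScalePair_real⟩)))
    (sat_cutsSentence.1 ((key _).2 (sat_cutsSentence.2 cutsConjugate_real)))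
    (sat_posSentence.1 ((key _).2 (sat_posSentence.2 ?_)))
  obtain ⟨h, hh, -⟩ := intervalsSupport_real 0 1 one_pos
  exact ⟨h, hh⟩

end LPerm
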